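/- Fix positive integers k and d and a permutation σ of {1,…,k}. For each n ≥ k, regard σ as a permutation of {1,…,n} fixing k+1,…,n. Then the proportion of irreducible complex characters χ of the symmetric group S_n such that d divides χ(σ), among all irreducible complex characters of S_n, tends to 1 as n → ∞. -/

import Mathlib

open Filter Topology CategoryTheory

section LinearAlgebra

variable {V : Type*} [AddCommGroup V] [Module ℂ V]

theorem isIntegral_trace_of_pow_succ_eq [FiniteDimensional ℂ V] {A : Module.End ℂ V} {M : ℕ}
    (hM : M ≠ 0)
    (hA : A ^ (M + 1) = A) : IsIntegral ℤ (LinearMap.trace ℂ V A) := by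
  rw [Module.End.trace_eq_sum_roots_charpoly_of_splits (IsAlgClosed.splits _)]
  refine IsIntegral.multiset_sum fun μ hμ => ?_
  have hev : A.HasEigenvalue μ := by
    rw [Module.End.hasEigenvalue_iff_isRoot_charpoly]
    exact Polynomial.isRoot_of_mem_roots hμ
  obtain ⟨v, hv⟩ := hev.exists_hasEigenvector
  have h1 := hv.pow_apply (M + 1)
  rw [hA, hv.apply_eq_smul] at h1
  have h2 : μ = μ ^ (M + 1) := smul_left_injective ℂ hv.2 h1
  have h3 : IsIntegral ℤ (μ ^ M) := by
    rcases eq_or_ne μ 0 with h | h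
    · rw [h, zero_pow hM]; exact isIntegral_zero
    · have : μ ^ M = 1 := by
        have := h2.symm
        rw [pow_succ] at this
        exact mul_right_cancel₀ h (by rw [this, one_mul])
      rw [this]; exact isIntegral_one
  exact IsIntegral.of_pow (Nat.pos_of_ne_zero hM) h3

/-- The average of the powers `B ^ j`, `j < N`. -/
noncomputable def powAverage (N : ℕ) (B : Module.End ℂ V) : Module.End ℂ V :=
  (N : ℂ)⁻¹ • ∑ j ∈ Finset.range N, B ^ j

theorem isIdempotentElem_powAverage {N : ℕ} (hN : N ≠ 0) {B : Module.End ℂ V} (hB : B ^ N = 1) :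
    IsIdempotentElem (powAverage N B) := by
  have h1 : B * ∑ j ∈ Finset.range N, B ^ j = ∑ j ∈ Finset.range N, B ^ j := by
    have := Finset.sum_range_succ (fun j => B ^ j) N
    rw [Finset.sum_range_succ', hB, pow_zero, add_left_inj] at this
    simpa [Finset.mul_sum, pow_succ'] using this
  have h2 : ∀ i : ℕ, B ^ i * powAverage N B = powAverage N B := by
    intro i
    induction i with
    | zero => simp
    | succ i ih =>
      rw [pow_succ, mul_assoc]
      conv_lhs => rw [powAverage, mul_smul_comm, h1]
      exact ih
  unfold IsIdempotentElem
  conv_lhs => enter [1]; rw [powAverage]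
  rw [smul_mul_assoc, Finset.sum_mul, Finset.sum_congr rfl fun i _ => h2 i, Finset.sum_const,
    Finset.card_range, ← Nat.cast_smul_eq_nsmul ℂ, smul_smul,
    inv_mul_cancel₀ (Nat.cast_ne_zero.2 hN), one_smul]

theorem isIntegral_trace_mul_powAverage [FiniteDimensional ℂ V] {N K : ℕ} (hN : N ≠ 0)
    (hK : K ≠ 0) {A B : Module.End ℂ V}
    (hAB : Commute A B) (hA : A ^ K = 1) (hB : B ^ N = 1) :
    IsIntegral ℤ (LinearMap.trace ℂ V (A * powAverage N B)) := by
  have hc : Commute A (powAverage N B) :=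
    (Commute.sum_right _ _ _ fun j _ => hAB.pow_right j).smul_right _
  refine isIntegral_trace_of_pow_succ_eq hK ?_
  rw [hc.mul_pow, (isIdempotentElem_powAverage hN hB).pow_succ_eq, pow_succ, hA, one_mul]

theorem exists_natCast_eq_trace_powAverage [FiniteDimensional ℂ V] {N : ℕ} (hN : N ≠ 0)
    {B : Module.End ℂ V}
    (hB : B ^ N = 1) : ∃ m : ℕ, LinearMap.trace ℂ V (powAverage N B) = m := by
  have h := (LinearMap.isProj_range_iff_isIdempotentElem _).2 (isIdempotentElem_powAverage hN hB)
  exact ⟨_, h.trace⟩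

theorem trace_mul_powAverage_smul (N : ℕ) (c : ℂ) (A B : Module.End ℂ V) :
    LinearMap.trace ℂ V (A * powAverage N (c • B)) =
      (N : ℂ)⁻¹ * ∑ j ∈ Finset.range N, c ^ j * LinearMap.trace ℂ V (A * B ^ j) := by
  simp [powAverage, Finset.mul_sum, smul_pow]

theorem isIntegral_trace_div [FiniteDimensional ℂ V] {q M K : ℕ} (hq : q ≠ 0) (hM : M ≠ 0)
    (hK : K ≠ 0)
    {A B : Module.End ℂ V} (hAB : Commute A B) (hA : A ^ K = 1) (hB : B ^ (q * M) = 1)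
    (h0 : ∀ j < q * M, ¬ q ∣ j → LinearMap.trace ℂ V (A * B ^ j) = 0) :
    IsIntegral ℤ (LinearMap.trace ℂ V A / q) := by
  have hN : q * M ≠ 0 := mul_ne_zero hq hM
  set ω := Complex.exp (2 * Real.pi * Complex.I / (q * M : ℕ)) with hω
  have hprim : IsPrimitiveRoot ω (q * M) := Complex.isPrimitiveRoot_exp _ hN
  have key : LinearMap.trace ℂ V A / q =
      ∑ t ∈ Finset.range M, LinearMap.trace ℂ V (A * powAverage (q * M) (ω ^ t • B)) := by
    simp_rw [trace_mul_powAverage_smul]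
    rw [← Finset.mul_sum, Finset.sum_comm, Finset.sum_eq_single 0]
    · have : (M : ℂ) ≠ 0 := Nat.cast_ne_zero.2 hM
      have : (q : ℂ) ≠ 0 := Nat.cast_ne_zero.2 hq
      simp
      field_simp
    · intro j hj hj0
      by_cases hqj : q ∣ j
      · rw [← Finset.sum_mul]
        have : ∑ t ∈ Finset.range M, (ω ^ t) ^ j = 0 := by
          simp_rw [← pow_mul, mul_comm _ j, pow_mul]
          have h1 : ω ^ j ≠ 1 := hprim.pow_ne_one_of_pos_of_lt hj0 (Finset.mem_range.1 hj)
          rw [geom_sum_eq h1]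
          obtain ⟨i, rfl⟩ := hqj
          rw [← pow_mul, mul_assoc, mul_comm i, ← mul_assoc, pow_mul, hprim.pow_eq_one]
          simp
        rw [this, zero_mul]
      · simp [h0 j (Finset.mem_range.1 hj) hqj]
    · intro h
      exact absurd (Finset.mem_range.2 (Nat.pos_of_ne_zero hN)) h
  rw [key]
  refine IsIntegral.sum _ fun t _ => ?_
  refine isIntegral_trace_mul_powAverage hN hK (hAB.smul_right _) hA ?_
  rw [smul_pow, hB, ← pow_mul, mul_comm t, pow_mul, hprim.pow_eq_one, one_pow, one_smul]

open Polynomial in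
theorem IsPrimitiveRoot.exists_intCast_eq_of_forall_coprime {N : ℕ} [NeZero N] (hN : 0 < N) {ω : ℂ}
    (hω : IsPrimitiveRoot ω N) (P : ℤ[X])
    (hP : ∀ u : ℕ, u.Coprime N → aeval (ω ^ u) P = aeval ω P) : ∃ z : ℤ, aeval ω P = z := by
  have hmon := cyclotomic.monic N ℤ
  set R := P %ₘ cyclotomic N ℤ with hR
  have hroot : ∀ ζ : ℂ, IsPrimitiveRoot ζ N → aeval ζ P = aeval ζ R := by
    intro ζ hζ
    have h1 := congrArg (aeval ζ) (modByMonic_add_div P (cyclotomic N ℤ))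
    have h2 : aeval ζ (cyclotomic N ℤ) = 0 := by
      rw [aeval_def, eval₂_eq_eval_map, map_cyclotomic]
      exact hζ.isRoot_cyclotomic hN
    rw [map_add, map_mul, h2, zero_mul, add_zero] at h1
    exact h1.symm
  set S : ℂ[X] := R.map (algebraMap ℤ ℂ) - C (aeval ω P) with hS
  have hS0 : S = 0 := by
    refine eq_zero_of_natDegree_lt_card_of_eval_eq_zero' S (primitiveRoots N ℂ) ?_ ?_
    · intro ζ hζ
      have hζ' := (mem_primitiveRoots hN).1 hζ
      obtain ⟨u, -, hu, rfl⟩ := hω.isPrimitiveRoot_iff.1 hζ'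
      rw [hS, eval_sub, eval_C, eval_map_algebraMap, ← hroot _ hζ', hP u hu, sub_self]
    · rw [hω.card_primitiveRoots]
      have hdeg : R.natDegree < N.totient := by
        rw [← natDegree_cyclotomic N ℤ]
        refine natDegree_modByMonic_lt P hmon ?_
        intro h
        have := natDegree_cyclotomic N ℤ
        rw [h, natDegree_one] at this
        exact (Nat.totient_pos.2 hN).ne this
      refine lt_of_le_of_lt (natDegree_sub_C.le) ?_
      exact lt_of_le_of_lt natDegree_map_le hdeg
  refine ⟨R.coeff 0, ?_⟩
  have := congrArg (fun T => coeff T 0) hS0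
  simp [hS] at this
  exact (sub_eq_zero.1 this).symm

open Polynomial in
theorem exists_intCast_eq_trace [FiniteDimensional ℂ V] {N : ℕ} (hN : N ≠ 0) {B : Module.End ℂ V}
    (hB : B ^ N = 1)
    (hu : ∀ u : ℕ, u.Coprime N → LinearMap.trace ℂ V (B ^ u) = LinearMap.trace ℂ V B) :
    ∃ z : ℤ, LinearMap.trace ℂ V B = z := by
  set ω := Complex.exp (2 * Real.pi * Complex.I / N) with hω
  have hprim : IsPrimitiveRoot ω N := Complex.isPrimitiveRoot_exp _ hN
  have hNC : (N : ℂ) ≠ 0 := Nat.cast_ne_zero.2 hN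
  have hm : ∀ t : ℕ, ∃ m : ℕ, LinearMap.trace ℂ V (powAverage N (ω⁻¹ ^ t • B)) = m := fun t =>
    exists_natCast_eq_trace_powAverage hN (by
      rw [_root_.smul_pow, hB, ← pow_mul, mul_comm t, pow_mul, hprim.inv.pow_eq_one, one_pow,
        one_smul])
  choose m hm using hm
  set P : ℤ[X] := ∑ t ∈ Finset.range N, C (m t : ℤ) * X ^ t with hPdef
  have hP : ∀ u : ℕ, aeval (ω ^ u) P = LinearMap.trace ℂ V (B ^ u) := by
    intro u
    have hm' : ∀ t, (m t : ℂ) =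
        (N : ℂ)⁻¹ * ∑ j ∈ Finset.range N, (ω⁻¹ ^ t) ^ j * LinearMap.trace ℂ V (B ^ j) := fun t => by
      rw [← hm, ← one_mul (powAverage N _), trace_mul_powAverage_smul]
      simp_rw [one_mul]
    have hlt : u % N < N := Nat.mod_lt _ (Nat.pos_of_ne_zero hN)
    have hω0 : ω ≠ 0 := hprim.ne_zero hN
    have hωu : ω ^ u = ω ^ (u % N) := (pow_mod_orderOf ω u ▸ by rw [hprim.eq_orderOf])
    have hBu : B ^ u = B ^ (u % N) := by
      conv_lhs => rw [← Nat.div_add_mod u N, pow_add, pow_mul, hB, one_pow, one_mul]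
    rw [hPdef, map_sum, hωu, hBu]
    simp only [map_mul, map_pow, aeval_X, map_natCast, hm', mul_assoc, Finset.sum_mul]
    rw [← Finset.mul_sum, Finset.sum_comm, Finset.sum_eq_single (u % N)]
    · have : ∀ t, (ω⁻¹ ^ t) ^ (u % N) * (LinearMap.trace ℂ V (B ^ (u % N)) * (ω ^ (u % N)) ^ t) =
          LinearMap.trace ℂ V (B ^ (u % N)) := fun t => by
        rw [← pow_mul, ← pow_mul, mul_comm t, inv_pow]
        field_simp
      simp_rw [this]
      simp [hNC]
    · intro j hj hju
      have : ∀ t, (ω⁻¹ ^ t) ^ j * (LinearMap.trace ℂ V (B ^ j) * (ω ^ (u % N)) ^ t) =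
          LinearMap.trace ℂ V (B ^ j) * (ω ^ (u % N) / ω ^ j) ^ t := fun t => by
        rw [← pow_mul, mul_comm t, pow_mul, div_pow, inv_pow, inv_pow]
        field_simp
      simp_rw [this]
      have hone : (ω ^ (u % N) / ω ^ j) ^ N = 1 := by
        rw [div_pow, pow_right_comm, pow_right_comm ω j, hprim.pow_eq_one]
        simp
      rw [← Finset.mul_sum, geom_sum_eq, hone]
      · simp
      · rw [Ne, div_eq_one_iff_eq (pow_ne_zero _ hω0)]
        exact fun h => hju (hprim.pow_inj hlt (Finset.mem_range.1 hj) h).symm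
    · exact fun h => absurd (Finset.mem_range.2 hlt) h
  have : NeZero N := ⟨hN⟩
  obtain ⟨z, hz⟩ := hprim.exists_intCast_eq_of_forall_coprime (Nat.pos_of_ne_zero hN) P
    (fun u h => by rw [hP, hu u h]; simpa using (hP 1).symm)
  refine ⟨z, ?_⟩
  rw [← hz]
  simpa using (hP 1).symm

end LinearAlgebra

theorem Equiv.Perm.cycleType_pow_of_coprime {α : Type*} [Fintype α] [DecidableEq α]
    (x : Equiv.Perm α) {u : ℕ} : u.Coprime (orderOf x) → (x ^ u).cycleType = x.cycleType := by
  induction x using Equiv.Perm.cycle_induction_on with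
  | base_one => simp
  | base_cycles x hx =>
    intro h
    have h1 : (x ^ u).IsCycle := hx.pow_iff.2 h
    rw [h1.cycleType, hx.cycleType, support_pow_coprime h]
  | induction_disjoint x y hd hx ihx ihy =>
    intro h
    have ho := hd.orderOf
    have hxy : (x * y) ^ u = x ^ u * y ^ u := hd.commute.mul_pow u
    rw [hxy, (hd.pow_disjoint_pow u u).cycleType_mul, hd.cycleType_mul,
      ihx (h.coprime_dvd_right (ho ▸ Nat.dvd_lcm_left _ _)),
      ihy (h.coprime_dvd_right (ho ▸ Nat.dvd_lcm_right _ _))]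

theorem Equiv.Perm.isConj_pow_of_coprime {α : Type*} [Fintype α] [DecidableEq α]
    (x : Equiv.Perm α) {u : ℕ} (h : u.Coprime (orderOf x)) : IsConj x (x ^ u) :=
  Equiv.Perm.isConj_iff_cycleType_eq.2 (x.cycleType_pow_of_coprime h).symm

theorem Equiv.Perm.card_centralizer_le {α : Type*} [Fintype α] [DecidableEq α]
    (x : Equiv.Perm α) (T : Finset α) (hT : ∀ y, ∃ t ∈ T, ∃ i : ℕ, y = (x ^ i) t) :
    Nat.card {c : Equiv.Perm α // Commute c x} ≤ Fintype.card α ^ T.card := by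
  have hinj : Function.Injective
      (fun (c : {c : Equiv.Perm α // Commute c x}) (t : T) => c.1 (t : α)) := by
    intro c c' h
    ext y
    obtain ⟨t, ht, i, rfl⟩ := hT y
    have h1 := (c.2.pow_right i).eq
    have h2 := (c'.2.pow_right i).eq
    have h3 : c.1 t = c'.1 t := congrFun h ⟨t, ht⟩
    rw [← Equiv.Perm.mul_apply, ← Equiv.Perm.mul_apply, h1, h2, Equiv.Perm.mul_apply,
      Equiv.Perm.mul_apply, h3]
  have := Nat.card_le_card_of_injective _ hinj
  simpa [Nat.card_eq_fintype_card] using this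

theorem Equiv.Perm.two_pow_sqrt_le_card_conjClasses (n : ℕ) :
    2 ^ (Nat.sqrt n - 1) ≤ Nat.card (ConjClasses (Equiv.Perm (Fin n))) := by
  have hex : ∀ s : Finset ℕ, s ∈ (Finset.Icc 2 (Nat.sqrt n)).powerset →
      ∃ g : Equiv.Perm (Fin n), g.cycleType = s.val := by
    intro s hs
    rw [Finset.mem_powerset] at hs
    rw [Equiv.Perm.exists_with_cycleType_iff]
    refine ⟨?_, fun a ha => (Finset.mem_Icc.1 (hs ha)).1⟩
    rw [← Multiset.map_id s.val, Fintype.card_fin]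
    calc (s.val.map id).sum ≤ ∑ a ∈ Finset.Icc 2 (Nat.sqrt n), a := Finset.sum_le_sum_of_subset hs
      _ ≤ (Finset.Icc 2 (Nat.sqrt n)).card • Nat.sqrt n :=
        Finset.sum_le_card_nsmul _ _ _ fun a ha => (Finset.mem_Icc.1 ha).2
      _ ≤ Nat.sqrt n * Nat.sqrt n := by
        rw [Nat.card_Icc, smul_eq_mul]; exact Nat.mul_le_mul_right _ (by omega)
      _ ≤ n := Nat.sqrt_le n
  choose! g hg using hex
  have hinj : Function.Injective (fun s : (Finset.Icc 2 (Nat.sqrt n)).powerset =>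
      ConjClasses.mk (g s)) := by
    intro s s' h
    have := Equiv.Perm.isConj_iff_cycleType_eq.1 (ConjClasses.mk_eq_mk_iff_isConj.1 h)
    rw [hg s s.2, hg s' s'.2] at this
    exact Subtype.ext (Finset.val_injective this)
  have := Nat.card_le_card_of_injective _ hinj
  rw [Nat.card_eq_fintype_card, Fintype.card_coe, Finset.card_powerset, Nat.card_Icc] at this
  exact this

/-- There is a permutation of `α` of order dividing `N` with at most `c` cycles. -/
def HasPermWithFewCycles (N c : ℕ) (α : Type) : Prop :=
  ∃ g : Equiv.Perm α, g ^ N = 1 ∧ ∃ T : Finset α, T.card ≤ c ∧ ∀ y, ∃ t ∈ T, ∃ i : ℕ, y = (g ^ i) t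

theorem HasPermWithFewCycles.congr {N c : ℕ} {α β : Type} (h : HasPermWithFewCycles N c α)
    (e : α ≃ β) : HasPermWithFewCycles N c β := by
  classical
  obtain ⟨g, hg, T, hT, h⟩ := h
  refine ⟨e.permCongrHom g, by rw [← map_pow, hg, map_one], T.map e.toEmbedding, by simpa using hT,
    fun y => ?_⟩
  obtain ⟨t, ht, i, hi⟩ := h (e.symm y)
  refine ⟨e t, by simpa using ht, i, ?_⟩
  rw [← map_pow]
  simp [Equiv.permCongrHom, Equiv.permCongr_apply, ← hi]

theorem Equiv.Perm.sumCongr_pow {α β : Type*} (a : Equiv.Perm α) (b : Equiv.Perm β) (i : ℕ) :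
    (Equiv.Perm.sumCongr a b) ^ i = Equiv.Perm.sumCongr (a ^ i) (b ^ i) :=
  (map_pow (Equiv.Perm.sumCongrHom α β) (a, b) i).symm

theorem HasPermWithFewCycles.sum {N c c' : ℕ} {α β : Type} (h : HasPermWithFewCycles N c α)
    (h' : HasPermWithFewCycles N c' β) : HasPermWithFewCycles N (c + c') (α ⊕ β) := by
  classical
  obtain ⟨g, hg, T, hT, h⟩ := h
  obtain ⟨g', hg', T', hT', h'⟩ := h'
  refine ⟨Equiv.Perm.sumCongr g g', by simp [Equiv.Perm.sumCongr_pow, hg, hg'], T.disjSum T',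
    by rw [Finset.card_disjSum]; omega, ?_⟩
  rintro (y | y)
  · obtain ⟨t, ht, i, rfl⟩ := h y
    exact ⟨Sum.inl t, by simpa using ht, i, by simp [Equiv.Perm.sumCongr_pow]⟩
  · obtain ⟨t, ht, i, rfl⟩ := h' y
    exact ⟨Sum.inr t, by simpa using ht, i, by simp [Equiv.Perm.sumCongr_pow]⟩

theorem HasPermWithFewCycles.mono {N N' c c' : ℕ} {α : Type} (h : HasPermWithFewCycles N c α)
    (hN : N ∣ N') (hc : c ≤ c') : HasPermWithFewCycles N' c' α := by
  obtain ⟨g, hg, T, hT, h⟩ := h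
  obtain ⟨k, rfl⟩ := hN
  exact ⟨g, by rw [pow_mul, hg, one_pow], T, hT.trans hc, h⟩

theorem hasPermWithFewCycles_prod_zmod (a N : ℕ) [NeZero N] :
    HasPermWithFewCycles N a (Fin a × ZMod N) := by
  classical
  have hpow : ∀ i : ℕ, ∀ y : Fin a × ZMod N,
      ((Equiv.prodCongr (Equiv.refl (Fin a)) (Equiv.addRight (1 : ZMod N)) :
        Equiv.Perm (Fin a × ZMod N)) ^ i) y = (y.1, y.2 + i) := by
    intro i
    induction i with
    | zero => simp
    | succ i ih => intro y; rw [pow_succ', Equiv.Perm.mul_apply, ih]; simp [add_assoc]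
  refine ⟨Equiv.prodCongr (Equiv.refl (Fin a)) (Equiv.addRight (1 : ZMod N)), ?_,
    Finset.univ.image fun b : Fin a => (b, (0 : ZMod N)), ?_, ?_⟩
  rotate_left
  · exact Finset.card_image_le.trans (by simp)
  · rintro ⟨b, z⟩
    exact ⟨(b, 0), by simp, z.val, by rw [hpow]; simp⟩
  · ext1 y; rw [hpow]; simp

theorem hasPermWithFewCycles_fin {p : ℕ} (hp : 0 < p) (s : ℕ) :
    ∀ m < p ^ s, HasPermWithFewCycles (p ^ s) (p * s) (Fin m) := by
  induction s with
  | zero =>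
    intro m hm
    obtain rfl : m = 0 := by simpa using hm
    exact ⟨1, by simp, ∅, by simp, fun y => y.elim0⟩
  | succ s ih =>
    intro m hm
    have hps : 0 < p ^ s := pow_pos hp s
    have : NeZero (p ^ s) := ⟨hps.ne'⟩
    have h1 : m / p ^ s < p := by rw [Nat.div_lt_iff_lt_mul hps, ← pow_succ']; exact hm
    have h2 := (hasPermWithFewCycles_prod_zmod (m / p ^ s) (p ^ s)).sum
      (ih (m % p ^ s) (Nat.mod_lt _ hps))
    have e : (Fin (m / p ^ s) × ZMod (p ^ s)) ⊕ Fin (m % p ^ s) ≃ Fin m :=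
      Fintype.equivFinOfCardEq (by simp [ZMod.card, Nat.div_add_mod'])
    exact (h2.congr e).mono (pow_dvd_pow p s.le_succ) (by rw [mul_add_one]; omega)

section Characters

variable (G : Type) [Group G]

/-- The set of irreducible complex characters of `G`. -/
def irrChars : Set (G → ℂ) := {χ | ∃ V : FDRep ℂ G, Simple V ∧ χ = V.character}

variable {G}

theorem simple_of_isIrreducible [Finite G] {V : Type} [AddCommGroup V] [Module ℂ V]
    [Module.Finite ℂ V] (ρ : Representation ℂ G V) [ρ.IsIrreducible] : Simple (FDRep.of ρ) := by
  have := Fintype.ofFinite G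
  rw [FDRep.simple_iff_char_is_norm_one]
  have : Invertible (Nat.card G : ℂ) := invertibleOfNonzero (Nat.cast_ne_zero.2 Nat.card_pos.ne')
  have h := Representation.char_orthonormal ρ ρ
  rw [if_pos ⟨Representation.Equiv.refl ρ⟩] at h
  have h2 : (Nat.card G : ℂ) ≠ 0 := Nat.cast_ne_zero.2 Nat.card_pos.ne'
  field_simp at h
  exact h

theorem asAlgebraHom_ofModule'_apply {M : Type*} [AddCommGroup M] [Module ℂ M]
    [Module (MonoidAlgebra ℂ G) M] [IsScalarTower ℂ (MonoidAlgebra ℂ G) M]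
    (r : MonoidAlgebra ℂ G) (m : M) :
    (Representation.ofModule' (k := ℂ) (G := G) M).asAlgebraHom r m = r • m := by
  simp [Representation.asAlgebraHom_def, Representation.ofModule']

theorem isIrreducible_ofModule' (M : Type*) [AddCommGroup M] [Module ℂ M]
    [Module (MonoidAlgebra ℂ G) M] [IsScalarTower ℂ (MonoidAlgebra ℂ G) M]
    [IsSimpleModule (MonoidAlgebra ℂ G) M] :
    (Representation.ofModule' (k := ℂ) (G := G) M).IsIrreducible := by
  set ρ := Representation.ofModule' (k := ℂ) (G := G) M with hρ
  rw [Representation.irreducible_iff_isSimpleModule_asModule]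
  let e : ρ.asModule ≃ₗ[MonoidAlgebra ℂ G] M :=
    { ρ.asModuleEquiv.toAddEquiv with
      map_smul' := fun r m => by
        have h := ρ.asModuleEquiv_map_smul r m
        rw [hρ, asAlgebraHom_ofModule'_apply] at h
        exact h }
  exact IsSimpleModule.congr e

theorem asAlgebraHom_eq_zero_of_trace_eq_zero {V : Type} [AddCommGroup V] [Module ℂ V]
    [Module.Finite ℂ V] (ρ : Representation ℂ G V) [ρ.IsIrreducible] (z : MonoidAlgebra ℂ G)
    (hz : ∀ a, a * z = z * a) (htr : LinearMap.trace ℂ V (ρ.asAlgebraHom z) = 0) :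
    ρ.asAlgebraHom z = 0 := by
  let F : Representation.IntertwiningMap ρ ρ :=
    { ρ.asAlgebraHom z with
      isIntertwining' := fun g => by
        have := congrArg ρ.asAlgebraHom (hz (MonoidAlgebra.single g 1))
        rw [map_mul, map_mul, Representation.asAlgebraHom_single_one] at this
        exact this.symm }
  obtain ⟨c, hc⟩ :=
    Representation.IsIrreducible.algebraMap_intertwiningMap_bijective_of_isAlgClosed.2 F
  have hF : ρ.asAlgebraHom z = c • LinearMap.id := by
    have := congrArg (fun T : Representation.IntertwiningMap ρ ρ => T.toLinearMap) hc
    exact this.symm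
  rw [hF, map_smul, LinearMap.trace_id, smul_eq_mul, mul_eq_zero] at htr
  rcases htr with h | h
  · rw [hF, h, zero_smul]
  · have := Module.finrank_zero_iff.1 (Nat.cast_eq_zero.1 h)
    exact Subsingleton.elim _ _

open scoped MonoidAlgebra in
/-- A class function orthogonal to all irreducible characters vanishes. -/
theorem eq_zero_of_forall_irrChars [Fintype G] (f : ConjClasses G → ℂ)
    (hf : ∀ χ ∈ irrChars G, ∑ g, f (ConjClasses.mk g) * χ g = 0) : f = 0 := by
  classical
  set z : MonoidAlgebra ℂ G := ∑ g, MonoidAlgebra.single g (f (ConjClasses.mk g)) with hz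
  have hcomm : ∀ a : MonoidAlgebra ℂ G, a * z = z * a := by
    intro a
    induction a using MonoidAlgebra.induction_linear with
    | zero => simp
    | add a b ha hb => rw [add_mul, mul_add, ha, hb]
    | single h c =>
      rw [hz, Finset.mul_sum, Finset.sum_mul]
      refine Fintype.sum_equiv (MulAut.conj h).toEquiv _ _ fun g => ?_
      have : ConjClasses.mk ((MulAut.conj h).toEquiv g) = ConjClasses.mk g :=
        ConjClasses.mk_eq_mk_iff_isConj.2 (isConj_iff.2 ⟨h⁻¹, by simp [mul_assoc]⟩)
      rw [this]
      simp [MonoidAlgebra.single_mul_single, mul_comm c]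
  have hz0 : z ∈ Ring.jacobson (MonoidAlgebra ℂ G) := by
    rw [Ring.jacobson_eq_sInf_isMaximal, Submodule.mem_sInf]
    intro I hI
    have hI' : IsCoatom I := Ideal.isMaximal_def.1 hI
    have hs : IsSimpleModule (MonoidAlgebra ℂ G) (MonoidAlgebra ℂ G ⧸ I) :=
      isSimpleModule_iff_isCoatom.2 hI'
    let ρ := Representation.ofModule' (k := ℂ) (G := G) (MonoidAlgebra ℂ G ⧸ I)
    have hirr := isIrreducible_ofModule' (G := G) (MonoidAlgebra ℂ G ⧸ I)
    have hfin : Module.Finite ℂ (MonoidAlgebra ℂ G ⧸ I) := Module.Finite.trans (MonoidAlgebra ℂ G) _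
    have hχ := hf _ ⟨FDRep.of ρ, simple_of_isIrreducible ρ, rfl⟩
    have h0 := asAlgebraHom_eq_zero_of_trace_eq_zero ρ z hcomm (by
      rw [hz, map_sum, map_sum, ← hχ]
      refine Finset.sum_congr rfl fun g _ => ?_
      rw [Representation.asAlgebraHom_single, map_smul]
      rfl)
    have h1 := asAlgebraHom_ofModule'_apply z (Submodule.Quotient.mk 1 : MonoidAlgebra ℂ G ⧸ I)
    rw [h0, LinearMap.zero_apply, ← Submodule.Quotient.mk_smul, eq_comm,
      Submodule.Quotient.mk_eq_zero] at h1
    simpa using h1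
  rw [IsSemisimpleRing.jacobson_eq_bot, Submodule.mem_bot] at hz0
  ext c
  obtain ⟨g, rfl⟩ := ConjClasses.exists_rep c
  have := congrArg (fun w : MonoidAlgebra ℂ G => w.coeff g) hz0
  simpa [hz, MonoidAlgebra.coeff_sum, Finsupp.single_apply] using this

theorem sum_mul_inv_of_mem_irrChars [Fintype G] {χ ψ : G → ℂ} (hχ : χ ∈ irrChars G)
    (hψ : ψ ∈ irrChars G) [Decidable (χ = ψ)] :
    ∑ g, χ g * ψ g⁻¹ = if χ = ψ then (Nat.card G : ℂ) else 0 := by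
  obtain ⟨V, hV, rfl⟩ := hχ
  obtain ⟨W, hW, rfl⟩ := hψ
  have h2 : (Nat.card G : ℂ) ≠ 0 := Nat.cast_ne_zero.2 Nat.card_pos.ne'
  split_ifs with h
  · rw [← h]
    exact (FDRep.simple_iff_char_is_norm_one V).1 hV
  · have : Invertible (Nat.card G : ℂ) := invertibleOfNonzero h2
    have h3 := FDRep.char_orthonormal V W
    rw [if_neg fun ⟨i⟩ => h (FDRep.char_iso i)] at h3
    exact (mul_eq_zero.1 h3).resolve_left (inv_ne_zero h2)

theorem linearIndependent_irrChars [Finite G] :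
    LinearIndependent ℂ (fun χ : irrChars G => (χ : G → ℂ)) := by
  classical
  have := Fintype.ofFinite G
  rw [linearIndependent_iff']
  intro s a ha ψ hψ
  have h1 : ∑ g, (∑ χ ∈ s, a χ • (χ : G → ℂ)) g * (ψ : G → ℂ) g⁻¹ = 0 := by
    rw [ha]; simp
  simp only [Finset.sum_apply, Pi.smul_apply, smul_eq_mul, Finset.sum_mul, mul_assoc] at h1
  rw [Finset.sum_comm] at h1
  simp_rw [← Finset.mul_sum, sum_mul_inv_of_mem_irrChars (Subtype.prop _) ψ.2] at h1
  simpa [← Subtype.ext_iff, hψ, Nat.card_pos.ne'] using h1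

instance finite_irrChars [Finite G] : Finite (irrChars G) := by
  have := Fintype.ofFinite G
  exact linearIndependent_irrChars.finite

theorem card_conjClasses_le_card_irrChars [Finite G] :
    Nat.card (ConjClasses G) ≤ Nat.card (irrChars G) := by
  classical
  have := Fintype.ofFinite G
  have := Fintype.ofFinite (ConjClasses G)
  have := Fintype.ofFinite (irrChars G)
  let Φ : (ConjClasses G → ℂ) →ₗ[ℂ] (irrChars G → ℂ) :=
    { toFun := fun f χ => ∑ g, f (ConjClasses.mk g) * (χ : G → ℂ) g
      map_add' := fun f f' => by ext; simp [add_mul, Finset.sum_add_distrib]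
      map_smul' := fun c f => by ext; simp [mul_assoc, Finset.mul_sum] }
  have hΦ : Function.Injective Φ := by
    rw [← LinearMap.ker_eq_bot, LinearMap.ker_eq_bot']
    exact fun f hf => eq_zero_of_forall_irrChars f fun χ hχ => congrFun hf ⟨χ, hχ⟩
  have := LinearMap.finrank_le_finrank_of_injective hΦ
  simpa [Nat.card_eq_fintype_card] using this

end Characters

theorem sum_sq_le_card_centralizer {G ι : Type*} [Group G] [Fintype G] [Fintype ι]
    [DecidableEq ι] (v : ι → G → ℝ) (hconj : ∀ i h y, v i (h * y * h⁻¹) = v i y)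
    (horth : ∀ i j, ∑ y, v i y * v j y = if i = j then (Nat.card G : ℝ) else 0) (x : G) :
    ∑ i, v i x ^ 2 ≤ (Nat.card {c : G // Commute c x} : ℝ) := by
  classical
  set f : G → ℝ := fun y => ∑ h : G, if h * x * h⁻¹ = y then 1 else 0 with hf
  have hsum (g : G → ℝ) : ∑ y, f y * g y = ∑ h : G, g (h * x * h⁻¹) := by
    simp_rw [hf, Finset.sum_mul]
    rw [Finset.sum_comm]
    simp
  have hfx (h : G) : f (h * x * h⁻¹) = Nat.card {c : G // Commute c x} := by
    rw [Nat.card_eq_fintype_card, Fintype.card_subtype, hf]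
    simp only
    rw [Finset.sum_boole]
    norm_cast
    refine Finset.card_bij' (fun a _ => h⁻¹ * a) (fun c _ => h * c) ?_ ?_ ?_ ?_
    · intro a ha
      simp only [Finset.mem_filter, Finset.mem_univ, true_and] at ha ⊢
      show h⁻¹ * a * x = x * (h⁻¹ * a)
      have : a * x = h * x * h⁻¹ * a := by rw [← ha]; group
      rw [mul_assoc, this]; group
    · intro c hc
      simp only [Finset.mem_filter, Finset.mem_univ, true_and] at hc ⊢
      rw [mul_assoc h c x, hc.eq]; group
    · intro a _; simp
    · intro a _; simp
  have hff : ∑ y, f y * f y = Nat.card G * Nat.card {c : G // Commute c x} := by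
    rw [hsum, Finset.sum_congr rfl fun h _ => hfx h]
    simp
  have hfv (i) : ∑ y, f y * v i y = Nat.card G * v i x := by
    rw [hsum, Finset.sum_congr rfl fun h _ => hconj i h x]
    simp
  have hw (g : G → ℝ) : ∑ y, g y * ∑ i, v i x * v i y = ∑ i, v i x * ∑ y, g y * v i y := by
    simp_rw [Finset.mul_sum]
    rw [Finset.sum_comm]
    exact Finset.sum_congr rfl fun i _ => Finset.sum_congr rfl fun y _ => by ring
  have hvw (i) : ∑ y, v i y * ∑ j, v j x * v j y = Nat.card G * v i x := by
    rw [hw]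
    simp [horth, mul_comm]
  have hww : ∑ y, (∑ i, v i x * v i y) * ∑ i, v i x * v i y = Nat.card G * ∑ i, v i x ^ 2 := by
    rw [hw, Finset.mul_sum]
    refine Finset.sum_congr rfl fun i _ => ?_
    rw [Finset.sum_congr rfl fun y _ => mul_comm _ _, hvw]
    ring
  have hfw : ∑ y, f y * ∑ i, v i x * v i y = Nat.card G * ∑ i, v i x ^ 2 := by
    rw [hw, Finset.mul_sum]
    refine Finset.sum_congr rfl fun i _ => ?_
    rw [hfv]
    ring
  have hpos : 0 ≤ ∑ y, (f y - ∑ i, v i x * v i y) ^ 2 := Finset.sum_nonneg fun y _ => sq_nonneg _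
  have hexp : ∑ y, (f y - ∑ i, v i x * v i y) ^ 2 =
      Nat.card G * (Nat.card {c : G // Commute c x} - ∑ i, v i x ^ 2) := by
    have (y : G) : (f y - ∑ i, v i x * v i y) ^ 2 = f y * f y - 2 * (f y * ∑ i, v i x * v i y) +
      (∑ i, v i x * v i y) * ∑ i, v i x * v i y := by ring
    simp_rw [this, Finset.sum_add_distrib, Finset.sum_sub_distrib, ← Finset.mul_sum, hff, hfw, hww]
    ring
  rw [hexp] at hpos
  have hG : (0 : ℝ) < Nat.card G := by exact_mod_cast Nat.card_pos
  linarith [nonneg_of_mul_nonneg_right hpos hG]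

theorem exists_intCast_eq_of_mem_irrChars {α : Type} [Fintype α] [DecidableEq α]
    {χ : Equiv.Perm α → ℂ} (hχ : χ ∈ irrChars (Equiv.Perm α)) (x : Equiv.Perm α) :
    ∃ z : ℤ, χ x = z := by
  obtain ⟨V, -, rfl⟩ := hχ
  refine exists_intCast_eq_trace (orderOf_pos x).ne' (B := V.ρ x) ?_ fun u hu => ?_
  · rw [← map_pow, pow_orderOf_eq_one, map_one]
  · obtain ⟨c, hc⟩ := isConj_iff.1 (Equiv.Perm.isConj_pow_of_coprime x hu)
    rw [← map_pow, ← hc]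
    exact V.char_conj x c

theorem apply_conj_of_mem_irrChars {G : Type} [Group G] {χ : G → ℂ} (hχ : χ ∈ irrChars G)
    (h x : G) : χ (h * x * h⁻¹) = χ x := by
  obtain ⟨V, -, rfl⟩ := hχ
  exact V.char_conj x h

theorem apply_inv_of_mem_irrChars {α : Type} [Fintype α] [DecidableEq α]
    {χ : Equiv.Perm α → ℂ} (hχ : χ ∈ irrChars (Equiv.Perm α)) (x : Equiv.Perm α) :
    χ x⁻¹ = χ x := by
  obtain ⟨c, hc⟩ := isConj_iff.1 (Equiv.Perm.isConj_iff_cycleType_eq.2 (x.cycleType_inv).symm)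
  rw [← hc, apply_conj_of_mem_irrChars hχ]

theorem card_irrChars_apply_ne_zero_le {α : Type} [Fintype α] [DecidableEq α]
    (x : Equiv.Perm α) :
    Nat.card {χ : irrChars (Equiv.Perm α) // χ.1 x ≠ 0} ≤
      Nat.card {c : Equiv.Perm α // Commute c x} := by
  classical
  have := Fintype.ofFinite (irrChars (Equiv.Perm α))
  have hre (χ : irrChars (Equiv.Perm α)) (y) : ((χ.1 y).re : ℂ) = χ.1 y := by
    obtain ⟨z, hz⟩ := exists_intCast_eq_of_mem_irrChars χ.2 y
    rw [hz]; simp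
  have h := sum_sq_le_card_centralizer (fun (χ : irrChars (Equiv.Perm α)) y => (χ.1 y).re)
    (fun χ h y => by rw [apply_conj_of_mem_irrChars χ.2]) (fun χ ψ => by
      have h := sum_mul_inv_of_mem_irrChars χ.2 ψ.2
      simp_rw [apply_inv_of_mem_irrChars ψ.2, SetCoe.ext_iff] at h
      rw [Finset.sum_congr rfl fun y _ => by rw [← hre χ, ← hre ψ]] at h
      split_ifs at h ⊢ <;> exact_mod_cast h) x
  rw [Nat.card_eq_fintype_card, Fintype.card_subtype, Finset.card_filter]
  refine (Nat.cast_le (α := ℝ)).1 (le_trans ?_ h)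
  push_cast
  refine Finset.sum_le_sum fun χ _ => ?_
  obtain ⟨z, hz⟩ := exists_intCast_eq_of_mem_irrChars χ.2 x
  by_cases hz0 : z = 0
  · simp [hz, hz0]
  · have : 1 ≤ z ^ 2 := Int.add_one_le_iff.2 (sq_pos_of_ne_zero hz0)
    simp only [hz, Complex.intCast_re, ne_eq, Int.cast_eq_zero, hz0, not_false_eq_true, if_true]
    exact_mod_cast this

theorem card_not_isIntegral_le {α : Type} [Fintype α] [DecidableEq α] {q M : ℕ} (hq : q ≠ 0)
    (hM : M ≠ 0) {x g : Equiv.Perm α} (hxg : Commute x g) (hg : g ^ (q * M) = 1) (T : Finset α)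
    (hT : ∀ j, ¬ q ∣ j → ∀ y, ∃ t ∈ T, ∃ i : ℕ, y = ((x * g ^ j) ^ i) t) :
    Nat.card {χ : irrChars (Equiv.Perm α) // ¬ IsIntegral ℤ (χ.1 x / (q : ℂ))} ≤
      q * M * Fintype.card α ^ T.card := by
  classical
  have hsub : {χ : irrChars (Equiv.Perm α) | ¬ IsIntegral ℤ (χ.1 x / (q : ℂ))} ⊆
      ⋃ j ∈ (Finset.range (q * M)).filter (¬ q ∣ ·),
        {χ : irrChars (Equiv.Perm α) | χ.1 (x * g ^ j) ≠ 0} := by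
    intro χ hχ
    by_contra hcon
    simp only [Set.mem_iUnion, not_exists, Set.mem_ofPred_eq, not_not, Finset.mem_filter,
      Finset.mem_range] at hcon
    refine hχ ?_
    obtain ⟨⟨_, V, hV, rfl⟩, -⟩ := χ, hχ
    refine isIntegral_trace_div hq hM (orderOf_pos x).ne' (A := V.ρ x) (B := V.ρ g)
      (hxg.map V.ρ) ?_ ?_ fun j hj hqj => ?_
    · rw [← map_pow, pow_orderOf_eq_one, map_one]
    · rw [← map_pow, hg, map_one]
    · rw [← map_pow, ← map_mul]
      exact hcon j ⟨hj, hqj⟩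
  calc Nat.card {χ : irrChars (Equiv.Perm α) // ¬ IsIntegral ℤ (χ.1 x / (q : ℂ))}
      = Set.ncard {χ : irrChars (Equiv.Perm α) | ¬ IsIntegral ℤ (χ.1 x / (q : ℂ))} := rfl
    _ ≤ _ := Set.ncard_le_ncard hsub (Set.toFinite _)
    _ ≤ ∑ j ∈ (Finset.range (q * M)).filter (¬ q ∣ ·),
        Set.ncard {χ : irrChars (Equiv.Perm α) | χ.1 (x * g ^ j) ≠ 0} :=
      Finset.set_ncard_biUnion_le _ _
    _ ≤ ∑ j ∈ (Finset.range (q * M)).filter (¬ q ∣ ·), Fintype.card α ^ T.card := by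
      refine Finset.sum_le_sum fun j hj => ?_
      exact (card_irrChars_apply_ne_zero_le _).trans
        (Equiv.Perm.card_centralizer_le _ T (hT j (Finset.mem_filter.1 hj).2))
    _ ≤ q * M * Fintype.card α ^ T.card := by
      rw [Finset.sum_const, smul_eq_mul]
      exact Nat.mul_le_mul_right _ ((Finset.card_filter_le _ _).trans (Finset.card_range _).le)

/-- Since `j` is not divisible by `p ^ a`, the powers of `g ^ j` include those of `g ^ (p ^ b)` for
some `b < a`. -/
theorem exists_pow_pow_apply_eq {α : Type*} {p a s j : ℕ} (hp : p.Prime) (has : a ≤ s)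
    (hj : ¬ p ^ a ∣ j) {g : Equiv.Perm α} (hg : g ^ p ^ s = 1) (i : ℕ) (t : α) :
    ∃ r < p ^ a, ∃ l : ℕ, (g ^ i) t = ((g ^ j) ^ l) ((g ^ r) t) := by
  obtain ⟨b, -, hb⟩ := (Nat.dvd_prime_pow hp).1 (Nat.gcd_dvd_right j (p ^ s))
  have hba : b < a := by
    by_contra! h
    exact hj ((pow_dvd_pow p h).trans (hb ▸ Nat.gcd_dvd_left j (p ^ s)))
  obtain ⟨u, -, hu⟩ := Nat.exists_mul_mod_eq_gcd (n := j) (k := p ^ s)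
    (hb ▸ Nat.pow_lt_pow_right hp.one_lt (hba.trans_le has))
  rw [hb] at hu
  refine ⟨i % p ^ b, (Nat.mod_lt _ (pow_pos hp.pos b)).trans
    (Nat.pow_lt_pow_right hp.one_lt hba), u * (i / p ^ b), ?_⟩
  rw [← Equiv.Perm.mul_apply, ← pow_mul, ← mul_assoc, pow_mul, pow_eq_pow_mod (j * u) hg, hu,
    ← pow_mul, ← pow_add, Nat.div_add_mod]

theorem card_not_isIntegral_prime_pow_le {α : Type} [Fintype α] [DecidableEq α] {k m p a s : ℕ}
    (hk : 0 < k) (hp : p.Prime) (has : a ≤ s) (hm : m < p ^ s) (σ : Equiv.Perm (Fin k))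
    (φ : Fin k ⊕ Fin m ≃ α) :
    Nat.card {χ : irrChars (Equiv.Perm α) //
        ¬ IsIntegral ℤ (χ.1 (φ.permCongrHom (σ.sumCongr 1)) / ((p ^ a : ℕ) : ℂ))} ≤
      p ^ s * (k + m) ^ (k + p ^ a * (p * s)) := by
  classical
  obtain ⟨g, hg, T, hTc, hT⟩ := hasPermWithFewCycles_fin hp.pos s m hm
  have hN : p ^ a * p ^ (s - a) = p ^ s := by rw [← pow_add, Nat.add_sub_cancel' has]
  have hcard : Fintype.card α = k + m := by simp [← Fintype.card_congr φ]
  set T' : Finset α := (Finset.univ.disjSum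
    ((Finset.range (p ^ a) ×ˢ T).image fun r => (g ^ r.1) r.2)).map φ.toEmbedding with hT'
  have hT'c : T'.card ≤ k + p ^ a * (p * s) := by
    rw [hT', Finset.card_map, Finset.card_disjSum, Finset.card_univ, Fintype.card_fin]
    refine Nat.add_le_add_left (Finset.card_image_le.trans ?_) k
    rw [Finset.card_product, Finset.card_range]
    exact Nat.mul_le_mul_left _ hTc
  have hmul (j : ℕ) : φ.permCongrHom (σ.sumCongr 1) * φ.permCongrHom (Equiv.Perm.sumCongr 1 g) ^ j =
      φ.permCongrHom (σ.sumCongr (g ^ j)) := by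
    rw [← map_pow, ← map_mul, Equiv.Perm.sumCongr_pow, Equiv.Perm.sumCongr_mul]
    simp
  refine (card_not_isIntegral_le (pow_pos hp.pos a).ne' (pow_pos hp.pos (s - a)).ne'
    (g := φ.permCongrHom (Equiv.Perm.sumCongr 1 g)) ?_ ?_ T' fun j hj y => ?_).trans ?_
  · refine Commute.map ?_ φ.permCongrHom
    rw [commute_iff_eq, Equiv.Perm.sumCongr_mul, Equiv.Perm.sumCongr_mul]
    simp
  · rw [hN, ← map_pow, Equiv.Perm.sumCongr_pow, hg, one_pow, Equiv.Perm.sumCongr_one, map_one]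
  · rw [hmul]
    obtain ⟨y, rfl⟩ := φ.surjective y
    rcases y with y | y
    · exact ⟨φ (Sum.inl y), by simp [hT'], 0, by simp⟩
    · obtain ⟨t, ht, i, rfl⟩ := hT y
      obtain ⟨r, hr, l, h⟩ := exists_pow_pow_apply_eq hp has hj hg i t
      refine ⟨φ (Sum.inr ((g ^ r) t)), ?_, l, ?_⟩
      · rw [hT', Finset.mem_map_equiv, φ.symm_apply_apply, Finset.inr_mem_disjSum,
          Finset.mem_image]
        exact ⟨(r, t), by simp [hr, ht], rfl⟩
      · rw [h, ← map_pow, Equiv.Perm.sumCongr_pow]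
        simp [Equiv.permCongrHom, Equiv.permCongr_apply]
  · rw [hN, hcard]
    exact Nat.mul_le_mul_left _ (Nat.pow_le_pow_right (by omega) hT'c)

theorem Equiv.Perm.viaFintypeEmbedding_castLEEmb {k m : ℕ} (σ : Equiv.Perm (Fin k))
    (h : k ≤ k + m) :
    σ.viaFintypeEmbedding (Fin.castLEEmb h) = finSumFinEquiv.permCongrHom (σ.sumCongr 1) := by
  ext1 y
  obtain ⟨y, rfl⟩ := finSumFinEquiv.surjective y
  rcases y with y | y
  · have := σ.viaFintypeEmbedding_apply_image (Fin.castLEEmb h) y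
    simp only [Equiv.permCongrHom_coe, Equiv.permCongr_apply, Equiv.symm_apply_apply]
    exact this
  · rw [Equiv.Perm.viaFintypeEmbedding_apply_notMem_range]
    · simp [Equiv.permCongrHom, Equiv.permCongr_apply]
    · rintro ⟨x, hx⟩
      have := congrArg Fin.val hx
      simp at this
      omega

/-- The irreducible characters of `S_n` whose value at `σ` is not divisible by `d`. -/
def badChars {k : ℕ} (σ : Equiv.Perm (Fin k)) (d n : ℕ) : Set (irrChars (Equiv.Perm (Fin n))) :=
  {χ | ∃ h : k ≤ n, ¬ IsIntegral ℤ (χ.1 (σ.viaFintypeEmbedding (Fin.castLEEmb h)) / (d : ℂ))}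

theorem card_badChars_prime_pow_le {k p a n : ℕ} (hk : 0 < k) (hkn : k ≤ n) (hp : p.Prime)
    (σ : Equiv.Perm (Fin k)) :
    (badChars σ (p ^ a) n).ncard ≤
      p ^ (Nat.log p n + 1 + a) * n ^ (k + p ^ a * (p * (Nat.log p n + 1 + a))) := by
  obtain ⟨m, rfl⟩ := Nat.exists_eq_add_of_le hkn
  set s := Nat.log p (k + m) + 1 + a with hs
  have hm : m < p ^ s := (Nat.le_add_left m k).trans_lt
    ((Nat.lt_pow_succ_log_self hp.one_lt _).trans_le (Nat.pow_le_pow_right hp.pos (by omega)))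
  refine le_trans ?_ (card_not_isIntegral_prime_pow_le hk hp (by omega) hm σ finSumFinEquiv)
  refine Set.ncard_le_ncard (t := {χ | ¬ IsIntegral ℤ _}) ?_ (Set.toFinite _)
  rintro χ ⟨h, hχ⟩
  rw [Equiv.Perm.viaFintypeEmbedding_castLEEmb] at hχ
  exact hχ

theorem exists_card_badChars_prime_pow_le {k p a : ℕ} (hk : 0 < k) (hp : p.Prime)
    (σ : Equiv.Perm (Fin k)) :
    ∃ C, ∀ n, (badChars σ (p ^ a) n).ncard ≤ 2 ^ (C * (Nat.log 2 n + 1) ^ 2) := by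
  refine ⟨p * (1 + a) + k + p ^ a * (p * (1 + a)), fun n => ?_⟩
  by_cases hkn : k ≤ n
  swap
  · have : badChars σ (p ^ a) n = ∅ := Set.eq_empty_of_forall_notMem fun χ ⟨h, _⟩ => hkn h
    simp [this]
  refine (card_badChars_prime_pow_le hk hkn hp σ).trans ?_
  set L := Nat.log 2 n with hL
  have h1 : Nat.log p n ≤ L := Nat.log_anti_left one_lt_two hp.two_le
  have h2 : Nat.log p n + 1 + a ≤ (1 + a) * (L + 1) := by nlinarith
  calc p ^ (Nat.log p n + 1 + a) * n ^ (k + p ^ a * (p * (Nat.log p n + 1 + a)))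
      ≤ (2 ^ p) ^ ((1 + a) * (L + 1)) *
        (2 ^ (L + 1)) ^ (k + p ^ a * (p * ((1 + a) * (L + 1)))) := by
        gcongr
        · exact Nat.one_le_two_pow
        · exact Nat.lt_two_pow_self.le
        · exact Nat.one_le_two_pow
        · exact (Nat.lt_pow_succ_log_self one_lt_two n).le
    _ = 2 ^ (p * ((1 + a) * (L + 1)) + (L + 1) * (k + p ^ a * (p * ((1 + a) * (L + 1))))) := by
        rw [← pow_mul, ← pow_mul, ← pow_add]
    _ ≤ 2 ^ ((p * (1 + a) + k + p ^ a * (p * (1 + a))) * (L + 1) ^ 2) := by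
        gcongr
        · exact one_le_two
        · have h3 : L + 1 ≤ (L + 1) ^ 2 := Nat.le_self_pow two_ne_zero _
          calc _ = (p * (1 + a) + k) * (L + 1) + p ^ a * (p * (1 + a)) * (L + 1) ^ 2 := by ring
            _ ≤ (p * (1 + a) + k) * (L + 1) ^ 2 + p ^ a * (p * (1 + a)) * (L + 1) ^ 2 := by gcongr
            _ = _ := by ring

theorem eventually_mul_sq_add_le_two_pow (C : ℕ) :
    ∀ᶠ L : ℕ in atTop, C * (L + 1) ^ 2 + L + 1 ≤ 2 ^ (L / 2) := by
  have h := tendsto_pow_const_div_const_pow_of_one_lt 2 (one_lt_two (α := ℝ))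
  have hD : (0 : ℝ) < ((16 * C + 4 : ℕ) : ℝ)⁻¹ := by positivity
  have h1 := (h.eventually (gt_mem_nhds hD)).and (eventually_ge_atTop 1)
  filter_upwards [(Nat.tendsto_div_const_atTop two_ne_zero).eventually h1] with L ⟨hL, hL1⟩
  set l := L / 2
  have hl : L + 1 ≤ 4 * l := by omega
  rw [div_lt_iff₀ (by positivity), inv_mul_eq_div, lt_div_iff₀ (by positivity)] at hL
  have hL' : l ^ 2 * (16 * C + 4) < 2 ^ l := by exact_mod_cast hL
  have h4 : (L + 1) ^ 2 ≤ (4 * l) ^ 2 := Nat.pow_le_pow_left hl 2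
  nlinarith [Nat.mul_le_mul_left C h4]

theorem tendsto_natLog_two_atTop : Tendsto (Nat.log 2) atTop atTop :=
  tendsto_atTop.2 fun b => (eventually_ge_atTop (2 ^ b)).mono fun _ hn =>
    Nat.le_log_of_pow_le one_lt_two hn

theorem two_pow_log_half_le_sqrt {n : ℕ} (hn : n ≠ 0) : 2 ^ (Nat.log 2 n / 2) ≤ Nat.sqrt n := by
  rw [Nat.le_sqrt, ← pow_add]
  exact (Nat.pow_le_pow_right two_pos (by omega)).trans (Nat.pow_log_le_self 2 hn)

theorem card_irrChars_perm_pos (n : ℕ) : 0 < Nat.card (irrChars (Equiv.Perm (Fin n))) :=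
  (Nat.two_pow_pos _).trans_le ((Equiv.Perm.two_pow_sqrt_le_card_conjClasses n).trans
    card_conjClasses_le_card_irrChars)

theorem tendsto_card_badChars_prime_pow {k p a : ℕ} (hk : 0 < k) (hp : p.Prime)
    (σ : Equiv.Perm (Fin k)) :
    Tendsto (fun n => ((badChars σ (p ^ a) n).ncard : ℝ) /
      Nat.card (irrChars (Equiv.Perm (Fin n)))) atTop (𝓝 0) := by
  obtain ⟨C, hC⟩ := exists_card_badChars_prime_pow_le (a := a) hk hp σ
  have hlim : Tendsto (fun n : ℕ => ((1 / 2 : ℝ)) ^ Nat.log 2 n) atTop (𝓝 0) :=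
    (tendsto_pow_atTop_nhds_zero_of_lt_one (by norm_num) (by norm_num)).comp
      tendsto_natLog_two_atTop
  refine squeeze_zero' (Eventually.of_forall fun n => by positivity) ?_ hlim
  filter_upwards [tendsto_natLog_two_atTop.eventually (eventually_mul_sq_add_le_two_pow C),
    eventually_ne_atTop 0] with n hn hn0
  set L := Nat.log 2 n
  have h1 := hn.trans (two_pow_log_half_le_sqrt hn0)
  have h2 : (badChars σ (p ^ a) n).ncard * 2 ^ L ≤ Nat.card (irrChars (Equiv.Perm (Fin n))) :=
    calc _ ≤ 2 ^ (C * (L + 1) ^ 2) * 2 ^ L := Nat.mul_le_mul_right _ (hC n)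
      _ = 2 ^ (C * (L + 1) ^ 2 + L) := (pow_add _ _ _).symm
      _ ≤ 2 ^ (Nat.sqrt n - 1) := Nat.pow_le_pow_right two_pos (by omega)
      _ ≤ _ := (Equiv.Perm.two_pow_sqrt_le_card_conjClasses n).trans
        card_conjClasses_le_card_irrChars
  have h3 : (0 : ℝ) < Nat.card (irrChars (Equiv.Perm (Fin n))) :=
    Nat.cast_pos.2 (card_irrChars_perm_pos n)
  rw [div_pow, one_pow, div_le_div_iff₀ h3 (by positivity), one_mul]
  exact_mod_cast h2

theorem badChars_mul_subset {k : ℕ} (σ : Equiv.Perm (Fin k)) {a b : ℕ} (ha : a ≠ 0) (hb : b ≠ 0)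
    (h : a.Coprime b) (n : ℕ) : badChars σ (a * b) n ⊆ badChars σ a n ∪ badChars σ b n := by
  rintro χ ⟨hkn, hχ⟩
  by_contra hcon
  simp only [Set.mem_union, not_or, badChars, Set.mem_ofPred_eq, not_exists, not_not] at hcon
  obtain ⟨u, v, huv⟩ := Nat.isCoprime_iff_coprime.2 h
  refine hχ ?_
  set z := χ.1 (σ.viaFintypeEmbedding (Fin.castLEEmb hkn))
  have huv' : (u : ℂ) * a + v * b = 1 := by exact_mod_cast huv
  have ha' : (a : ℂ) ≠ 0 := Nat.cast_ne_zero.2 ha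
  have hb' : (b : ℂ) ≠ 0 := Nat.cast_ne_zero.2 hb
  have : z / ((a * b : ℕ) : ℂ) = u * (z / b) + v * (z / a) := by
    push_cast
    field_simp
    linear_combination -z * huv'
  rw [this]
  exact ((isIntegral_algebraMap (x := u)).mul (hcon.2 hkn)).add
    ((isIntegral_algebraMap (x := v)).mul (hcon.1 hkn))

theorem tendsto_card_badChars {k : ℕ} (hk : 0 < k) (σ : Equiv.Perm (Fin k)) (d : ℕ) (hd : d ≠ 0) :
    Tendsto (fun n => ((badChars σ d n).ncard : ℝ) /
      Nat.card (irrChars (Equiv.Perm (Fin n)))) atTop (𝓝 0) := by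
  induction d using Nat.recOnPosPrimePosCoprime with
  | prime_pow p a hp ha => exact tendsto_card_badChars_prime_pow hk hp σ
  | zero => exact absurd rfl hd
  | one => simpa using tendsto_card_badChars_prime_pow (a := 0) hk Nat.prime_two σ
  | coprime a b ha hb hab iha ihb =>
    have h := (iha (by omega)).add (ihb (by omega))
    rw [add_zero] at h
    refine squeeze_zero (fun n => by positivity) (fun n => ?_) h
    rw [← add_div]
    gcongr
    exact_mod_cast (Set.ncard_le_ncard (badChars_mul_subset σ (by omega) (by omega) hab n)
      (Set.toFinite _)).trans (Set.ncard_union_le _ _)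

/-- Fix positive integers `k` and `d` and a permutation `σ` of `{1,…,k}`. Regarding `σ` as a
permutation of `{1,…,n}` fixing the remaining letters, the proportion of irreducible complex
characters `χ` of `S_n` such that `d` divides `χ(σ)` (i.e. `χ(σ)/d` is an algebraic integer),
among all irreducible complex characters of `S_n`, tends to `1` as `n → ∞`. -/
theorem stmt5 (k d : ℕ) (hk : 1 ≤ k) (hd : 1 ≤ d) (σ : Equiv.Perm (Fin k)) :
    Filter.Tendsto (fun n : ℕ =>
      (Nat.card {χ : Equiv.Perm (Fin n) → ℂ //
          (∃ V : FDRep ℂ (Equiv.Perm (Fin n)), Simple V ∧ χ = V.character) ∧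
          ∀ h : k ≤ n,
            IsIntegral ℤ (χ (σ.viaFintypeEmbedding (Fin.castLEEmb h)) / (d : ℂ))} : ℝ) /
      (Nat.card {χ : Equiv.Perm (Fin n) → ℂ //
          ∃ V : FDRep ℂ (Equiv.Perm (Fin n)), Simple V ∧ χ = V.character} : ℝ))
      Filter.atTop (𝓝 1) := by
  have h := (tendsto_card_badChars hk σ d (by omega)).const_sub 1
  rw [sub_zero] at h
  refine h.congr fun n => ?_
  have hpos : (0 : ℝ) < Nat.card (irrChars (Equiv.Perm (Fin n))) :=
    Nat.cast_pos.2 (card_irrChars_perm_pos n)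
  have hgood : Nat.card {χ : Equiv.Perm (Fin n) → ℂ //
      (∃ V : FDRep ℂ (Equiv.Perm (Fin n)), Simple V ∧ χ = V.character) ∧ ∀ h : k ≤ n,
        IsIntegral ℤ (χ (σ.viaFintypeEmbedding (Fin.castLEEmb h)) / (d : ℂ))} =
      ((badChars σ d n)ᶜ).ncard := by
    refine Nat.card_congr ((Equiv.subtypeSubtypeEquivSubtypeInter _ _).symm.trans
      (Equiv.subtypeEquivRight fun χ => ?_))
    change _ ↔ ¬ ∃ h : k ≤ n, ¬ _
    simp only [not_exists, not_not]
  have hsum : ((badChars σ d n).ncard : ℝ) + (badChars σ d n)ᶜ.ncard =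
      Nat.card (irrChars (Equiv.Perm (Fin n))) := by
    exact_mod_cast Set.ncard_add_ncard_compl (badChars σ d n)
  rw [hgood, one_sub_div hpos.ne', ← hsum, add_sub_cancel_left, hsum]
  rfl
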